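/- In the setting of the previous statement, suppose additionally there exists j₀ such that |α(j+1) − α(j)| ≤ d(j+1) − d(j) for all j ≥ j₀. Then there exists n₁ such that |λ_n(A) − d(n)| ≤ α(n) for all n ≥ n₁. -/

import Mathlib

open Filter

/- l²(ℕ*) is modeled as `lp (fun _ : ℕ => ℂ) 2` (index j ↔ paper index j+1;
the paper's convention "a_l(j-l) = 0, x(j-l) = 0 for j ≤ l" becomes the
`if l ≤ j` guards below). -/

/-- the off-diagonal band operator `A'`. -/
noncomputable def offDiagOp (m : ℕ) (a : ℕ → ℕ → ℝ) (x : ℕ → ℂ) (j : ℕ) : ℂ :=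
  ∑ l ∈ Finset.Icc 1 m, ((a l j : ℂ) * x (j + l) +
    if l ≤ j then (a l (j - l) : ℂ) * x (j - l) else 0)

/-- the full band operator `A = D + A'`. -/
noncomputable def bandOp (m : ℕ) (d : ℕ → ℝ) (a : ℕ → ℕ → ℝ) (x : ℕ → ℂ) (j : ℕ) : ℂ :=
  (d j : ℂ) * x j + offDiagOp m a x j

/-- `lam` is the nondecreasing enumeration (with multiplicity) of the eigenvalues
of the self-adjoint operator `A = D + A'` with compact resolvent: there is an
orthonormal basis `(v n)` of `l²` with `A (v n) = lam n • v n` and `lam n → ∞`,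
`lam` nondecreasing. -/
def IsEigenSystem (m : ℕ) (d : ℕ → ℝ) (a : ℕ → ℕ → ℝ)
    (lam : ℕ → ℝ) (v : ℕ → lp (fun _ : ℕ => ℂ) 2) : Prop :=
  Orthonormal ℂ v ∧
  (Submodule.span ℂ (Set.range v)).topologicalClosure = ⊤ ∧
  Monotone lam ∧ Tendsto lam atTop atTop ∧
  ∀ n j, bandOp m d a ((v n : lp (fun _ : ℕ => ℂ) 2) : ∀ _ : ℕ, ℂ) j
    = (lam n : ℂ) * (v n : ∀ _ : ℕ, ℂ) j

/-- the standing assumptions on `A = D + A'`: the relative decay condition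
(|a_l(j-l)|+|a_l(j)|)/d(j) → 0 ensuring self-adjointness, and d(n) → ∞
ensuring compactness of the resolvent. -/
def StandingAssumptions (m : ℕ) (d : ℕ → ℝ) (a : ℕ → ℕ → ℝ) : Prop :=
  (∀ l ∈ Finset.Icc 1 m, Tendsto
    (fun j => ((if l ≤ j then |a l (j - l)| else 0) + |a l j|) / d j) atTop (nhds 0)) ∧
  Tendsto d atTop atTop


/-- band matrix entries -/
def bandM {R : Type*} [CommRing R] (m : ℕ) (a : ℕ → ℕ → R) (j i : ℕ) : R :=
  ∑ l ∈ Finset.Icc 1 m, ((if i = j + l then a l j else 0) + (if j = i + l then a l i else 0))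

theorem bandM_symm {R : Type*} [CommRing R] (m : ℕ) (a : ℕ → ℕ → R) (j i : ℕ) :
    bandM m a j i = bandM m a i j := by
  unfold bandM
  exact Finset.sum_congr rfl fun l _ => add_comm _ _

theorem bandM_zero {R : Type*} [CommRing R] (m : ℕ) (a : ℕ → ℕ → R) (j i : ℕ)
    (h : j + m < i) : bandM m a j i = 0 := by
  unfold bandM
  refine Finset.sum_eq_zero fun l hl => ?_
  rw [Finset.mem_Icc] at hl
  rw [if_neg (by omega), if_neg (by omega), add_zero]

theorem bandM_row {R : Type*} [CommRing R] (m : ℕ) (a : ℕ → ℕ → R) (x : ℕ → R) (j N : ℕ)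
    (h : j + m < N) : ∑ i ∈ Finset.range N, bandM m a j i * x i =
      ∑ l ∈ Finset.Icc 1 m, (a l j * x (j + l) + if l ≤ j then a l (j - l) * x (j - l) else 0) := by
  unfold bandM
  simp_rw [Finset.sum_mul]
  rw [Finset.sum_comm]
  refine Finset.sum_congr rfl fun l hl => ?_
  rw [Finset.mem_Icc] at hl
  simp_rw [add_mul, ite_mul, zero_mul]
  rw [Finset.sum_add_distrib]
  congr 1
  · rw [Finset.sum_ite_eq', if_pos (Finset.mem_range.2 (by omega))]
  · split_ifs with hlj
    · rw [Finset.sum_eq_single (j - l)]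
      · rw [if_pos (by omega)]
      · intro b _ hb
        rw [if_neg (by omega)]
      · intro hb
        exact absurd (Finset.mem_range.2 (by omega)) hb
    · refine Finset.sum_eq_zero fun i _ => ?_
      rw [if_neg (by omega)]

theorem offDiag_eq (m : ℕ) (a : ℕ → ℕ → ℝ) (x : ℕ → ℂ) (j N : ℕ) (h : j + m < N) :
    offDiagOp m a x j = ∑ i ∈ Finset.range N, bandM m (fun l j => (a l j : ℂ)) j i * x i := by
  rw [bandM_row m _ x j N h]; rfl

theorem bandM_conj (m : ℕ) (a : ℕ → ℕ → ℝ) (j i : ℕ) :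
    (starRingEnd ℂ) (bandM m (fun l j => (a l j : ℂ)) j i) = bandM m (fun l j => (a l j : ℂ)) j i := by
  unfold bandM
  rw [map_sum]
  refine Finset.sum_congr rfl fun l _ => ?_
  rw [map_add]
  congr 1 <;> split_ifs <;> simp

theorem bandM_norm (m : ℕ) (a : ℕ → ℕ → ℝ) (j i : ℕ) :
    ‖bandM m (fun l j => (a l j : ℂ)) j i‖ ≤ bandM m (fun l j => |a l j|) j i := by
  unfold bandM
  refine (norm_sum_le _ _).trans (Finset.sum_le_sum fun l _ => (norm_add_le _ _).trans ?_)
  refine add_le_add ?_ ?_ <;> split_ifs <;> simp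

theorem bandM_nonneg (m : ℕ) (a : ℕ → ℕ → ℝ) (j i : ℕ) :
    0 ≤ bandM m (fun l j => |a l j|) j i := (norm_nonneg _).trans (bandM_norm m a j i)

theorem bandM_rowsum (m : ℕ) (a : ℕ → ℕ → ℝ) (α : ℕ → ℝ)
    (hα : ∀ j, (∑ l ∈ Finset.Icc 1 m, (|a l j| + if l ≤ j then |a l (j - l)| else 0)) ≤ α j)
    (j N : ℕ) : ∑ i ∈ Finset.range N, bandM m (fun l j => |a l j|) j i ≤ α j := by
  have h := bandM_row m (fun l j => |a l j|) (fun _ => 1) j (N + j + m + 1) (by omega)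
  simp only [mul_one] at h
  refine le_trans ?_ (h.le.trans (hα j))
  exact Finset.sum_le_sum_of_subset_of_nonneg (Finset.range_mono (by omega))
    fun i _ _ => bandM_nonneg m a j i

theorem form_est (m : ℕ) (d : ℕ → ℝ) (a : ℕ → ℕ → ℝ) (α : ℕ → ℝ)
    (hα : ∀ j, (∑ l ∈ Finset.Icc 1 m, (|a l j| + if l ≤ j then |a l (j - l)| else 0)) ≤ α j)
    (y : ℕ → ℂ) (N : ℕ) :
    |(∑ j ∈ Finset.range N, bandOp m d a y j * (starRingEnd ℂ) (y j)).re -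
      ∑ j ∈ Finset.range N, d j * ‖y j‖ ^ 2| ≤
    (∑ j ∈ Finset.range N, α j * ‖y j‖ ^ 2 + ∑ j ∈ Finset.range (N + m), α j * ‖y j‖ ^ 2) / 2 := by
  have h1 : (∑ j ∈ Finset.range N, bandOp m d a y j * (starRingEnd ℂ) (y j)).re -
      ∑ j ∈ Finset.range N, d j * ‖y j‖ ^ 2 =
      (∑ j ∈ Finset.range N, offDiagOp m a y j * (starRingEnd ℂ) (y j)).re := by
    rw [Complex.re_sum, Complex.re_sum, ← Finset.sum_sub_distrib]
    refine Finset.sum_congr rfl fun j _ => ?_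
    unfold bandOp
    rw [add_mul, mul_assoc, Complex.mul_conj, Complex.normSq_eq_norm_sq, Complex.add_re,
      ← Complex.ofReal_mul, Complex.ofReal_re]
    ring
  rw [h1]
  refine (Complex.abs_re_le_norm _).trans ((norm_sum_le _ _).trans ?_)
  have h2 : ∀ j ∈ Finset.range N, ‖offDiagOp m a y j * (starRingEnd ℂ) (y j)‖ ≤
      ∑ i ∈ Finset.range (N + m), (bandM m (fun l j => |a l j|) j i * ‖y j‖ ^ 2 / 2 +
        bandM m (fun l j => |a l j|) j i * ‖y i‖ ^ 2 / 2) := by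
    intro j hj
    rw [Finset.mem_range] at hj
    rw [offDiag_eq m a y j (N + m) (by omega), Finset.sum_mul]
    refine (norm_sum_le _ _).trans (Finset.sum_le_sum fun i _ => ?_)
    rw [norm_mul, norm_mul, RCLike.norm_conj]
    have e1 := bandM_norm m a j i
    have e2 := bandM_nonneg m a j i
    have e3 : ‖y i‖ * ‖y j‖ ≤ (‖y j‖ ^ 2 + ‖y i‖ ^ 2) / 2 := by
      nlinarith [sq_nonneg (‖y i‖ - ‖y j‖)]
    calc _ = ‖bandM m (fun l j => (a l j : ℂ)) j i‖ * (‖y i‖ * ‖y j‖) := by ring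
      _ ≤ bandM m (fun l j => |a l j|) j i * ((‖y j‖ ^ 2 + ‖y i‖ ^ 2) / 2) := by gcongr
      _ = _ := by ring
  refine (Finset.sum_le_sum h2).trans ?_
  simp_rw [Finset.sum_add_distrib]
  rw [add_div]
  refine add_le_add ?_ ?_
  · rw [Finset.sum_div]
    refine Finset.sum_le_sum fun j _ => ?_
    rw [← Finset.sum_div, ← Finset.sum_mul]
    have := bandM_rowsum m a α hα j (N + m)
    gcongr
  · rw [Finset.sum_comm, Finset.sum_div]
    refine Finset.sum_le_sum fun i _ => ?_
    rw [← Finset.sum_div, ← Finset.sum_mul]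
    have := bandM_rowsum m a α hα i N
    simp_rw [bandM_symm m _ _ i]
    gcongr

theorem alpha_ge (m : ℕ) (a : ℕ → ℕ → ℝ) (α : ℕ → ℝ)
    (hα : ∀ j, (∑ l ∈ Finset.Icc 1 m, (|a l j| + if l ≤ j then |a l (j - l)| else 0)) ≤ α j)
    (l : ℕ) (hl : l ∈ Finset.Icc 1 m) (j : ℕ) : |a l j| ≤ α j ∧ |a l j| ≤ α (j + l) := by
  have nn : ∀ j l, 0 ≤ (|a l j| + if l ≤ j then |a l (j - l)| else 0) := by
    intro j l
    split_ifs <;> positivity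
  have key : ∀ j, (|a l j| + if l ≤ j then |a l (j - l)| else 0) ≤ α j := fun j =>
    (Finset.single_le_sum (f := fun l => |a l j| + if l ≤ j then |a l (j - l)| else 0)
      (fun l _ => nn j l) hl).trans (hα j)
  constructor
  · refine le_trans ?_ (key j)
    have : 0 ≤ if l ≤ j then |a l (j - l)| else 0 := by split_ifs <;> positivity
    linarith
  · have := key (j + l)
    rw [if_pos (by omega), Nat.add_sub_cancel] at this
    linarith [abs_nonneg (a l (j + l))]

theorem alpha_nonneg (m : ℕ) (a : ℕ → ℕ → ℝ) (α : ℕ → ℝ)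
    (hα : ∀ j, (∑ l ∈ Finset.Icc 1 m, (|a l j| + if l ≤ j then |a l (j - l)| else 0)) ≤ α j)
    (j : ℕ) : 0 ≤ α j := by
  have := bandM_rowsum m a α hα j 0
  simpa using this

theorem reg (m : ℕ) (d : ℕ → ℝ) (a : ℕ → ℕ → ℝ) (α : ℕ → ℝ)
    (hα : ∀ j, (∑ l ∈ Finset.Icc 1 m, (|a l j| + if l ≤ j then |a l (j - l)| else 0)) ≤ α j)
    (n : ℕ) (hd : ∀ j ≥ n, 0 < d j) (δ : ℝ) (hδ : 0 < δ) (hδm : 4 * m * δ ≤ 1)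
    (hδα : ∀ j ≥ n, α j ≤ δ * d j) (y : ℕ → ℂ) (hy0 : ∀ j < n, y j = 0)
    (Y : ℝ) (hY : ∀ j, ‖y j‖ ≤ Y) (G : ℝ) (hG : ∀ j, ‖bandOp m d a y j‖ ≤ G) (j : ℕ) :
    d j * ‖y j‖ ≤ 2 * G := by
  have hG0 : 0 ≤ G := (norm_nonneg _).trans (hG 0)
  have step : ∀ K > 0, ∀ B ≥ 0, (∀ j, min (d j) K * ‖y j‖ ≤ B) →
      ∀ j, min (d j) K * ‖y j‖ ≤ G + B / 2 := by
    intro K hK B hB hBj j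
    rcases lt_or_ge j n with hj | hj
    · rw [hy0 j hj]; simp; positivity
    have dj := hd j hj
    set r := min (d j) K / d j with hr
    have hr0 : 0 ≤ r := by
      have : 0 ≤ min (d j) K := le_min dj.le hK.le
      positivity
    have hr1 : r ≤ 1 := by
      rw [hr, div_le_one dj]; exact min_le_left _ _
    have hrd : r * d j = min (d j) K := by rw [hr]; field_simp
    have term : ∀ c i, 0 ≤ c → c ≤ α j → c ≤ α i → r * (c * ‖y i‖) ≤ δ * B := by
      intro c i hc h1 h2
      rcases lt_or_ge i n with hi | hi
      · rw [hy0 i hi]; simp; positivity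
      have h3 : r * c ≤ δ * min (d i) K := by
        rw [mul_min_of_nonneg _ _ hδ.le]
        refine le_min ?_ ?_
        · calc r * c ≤ 1 * c := by gcongr
            _ ≤ δ * d i := by rw [one_mul]; exact h2.trans (hδα i hi)
        · calc r * c ≤ r * (δ * d j) := by gcongr; exact h1.trans (hδα j hj)
            _ = δ * min (d j) K := by rw [← hrd]; ring
            _ ≤ δ * K := by gcongr; exact min_le_right _ _
      calc r * (c * ‖y i‖) = (r * c) * ‖y i‖ := by ring
        _ ≤ (δ * min (d i) K) * ‖y i‖ := by gcongr
        _ = δ * (min (d i) K * ‖y i‖) := by ring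
        _ ≤ δ * B := by gcongr; exact hBj i
    have hoff : r * ‖offDiagOp m a y j‖ ≤ B / 2 := by
      have : r * ‖offDiagOp m a y j‖ ≤ ∑ l ∈ Finset.Icc 1 m, (δ * B + δ * B) := by
        unfold offDiagOp
        refine (mul_le_mul_of_nonneg_left (norm_sum_le _ _) hr0).trans ?_
        rw [Finset.mul_sum]
        refine Finset.sum_le_sum fun l hl => ?_
        refine (mul_le_mul_of_nonneg_left (norm_add_le _ _) hr0).trans ?_
        rw [mul_add]
        refine add_le_add ?_ ?_
        · rw [norm_mul, Complex.norm_real, Real.norm_eq_abs]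
          have := alpha_ge m a α hα l hl j
          exact term _ _ (abs_nonneg _) this.1 this.2
        · split_ifs with hlj
          · rw [norm_mul, Complex.norm_real, Real.norm_eq_abs]
            have := alpha_ge m a α hα l hl (j - l)
            rw [Nat.sub_add_cancel hlj] at this
            exact term _ _ (abs_nonneg _) this.2 this.1
          · simp; positivity
      rw [Finset.sum_const, Nat.card_Icc, nsmul_eq_mul] at this
      simp only [Nat.add_sub_cancel] at this
      nlinarith
    have hmain : d j * ‖y j‖ ≤ G + ‖offDiagOp m a y j‖ := by
      have e : (d j : ℂ) * y j = bandOp m d a y j - offDiagOp m a y j := by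
        unfold bandOp; ring
      have e2 : ‖(d j : ℂ) * y j‖ = d j * ‖y j‖ := by
        rw [norm_mul, Complex.norm_real, Real.norm_of_nonneg dj.le]
      rw [← e2, e]
      exact (norm_sub_le _ _).trans (by gcongr; exact hG j)
    calc min (d j) K * ‖y j‖ = r * (d j * ‖y j‖) := by rw [← hrd]; ring
      _ ≤ r * (G + ‖offDiagOp m a y j‖) := by gcongr
      _ = r * G + r * ‖offDiagOp m a y j‖ := by ring
      _ ≤ 1 * G + B / 2 := by gcongr
      _ = _ := by ring
  have fin : ∀ K > 0, ∀ j, min (d j) K * ‖y j‖ ≤ 2 * G := by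
    intro K hK
    have hY0 : 0 ≤ Y := (norm_nonneg _).trans (hY 0)
    have bdd : BddAbove (Set.range fun j => min (d j) K * ‖y j‖) := by
      refine ⟨K * Y, ?_⟩
      rintro _ ⟨j, rfl⟩
      calc min (d j) K * ‖y j‖ ≤ K * ‖y j‖ := by gcongr; exact min_le_right _ _
        _ ≤ K * Y := by gcongr; exact hY j
    set S := ⨆ j, min (d j) K * ‖y j‖ with hS
    have hSj : ∀ j, min (d j) K * ‖y j‖ ≤ S := fun j => le_ciSup bdd j
    have hS0 : 0 ≤ S := by
      have h := hSj n
      have : 0 ≤ min (d n) K * ‖y n‖ :=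
        mul_nonneg (le_min (hd n le_rfl).le hK.le) (norm_nonneg _)
      linarith
    have : S ≤ G + S / 2 := ciSup_le (step K hK S hS0 hSj)
    intro j
    linarith [hSj j]
  have := fin (max (d j) 1) (by positivity) j
  rwa [min_eq_left (le_max_left _ _)] at this

theorem exists_comb (n : ℕ) (T : ℕ → ℕ → ℂ) : ∃ c : ℕ → ℂ, (∀ j, n < j → c j = 0) ∧
    (∃ j, c j ≠ 0) ∧ ∀ k < n, ∑ j ∈ Finset.range (n + 1), T k j * c j = 0 := by
  let A : Matrix (Fin n) (Fin (n + 1)) ℂ := fun k j => T k j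
  have hk : LinearMap.ker A.mulVecLin ≠ ⊥ :=
    LinearMap.ker_ne_bot_of_finrank_lt (by simp)
  obtain ⟨c, hc, hc0⟩ := (Submodule.ne_bot_iff _).1 hk
  refine ⟨fun j => if h : j < n + 1 then c ⟨j, h⟩ else 0, ?_, ?_, ?_⟩
  · intro j hj
    exact dif_neg (by omega)
  · obtain ⟨j, hj⟩ := Function.ne_iff.1 hc0
    exact ⟨j, by simpa [Nat.lt_succ_iff.1 j.2] using hj⟩
  · intro k hk
    rw [LinearMap.mem_ker] at hc
    have := congrFun hc ⟨k, hk⟩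
    rw [Finset.sum_range]
    refine Eq.trans ?_ (show A.mulVecLin c ⟨k, hk⟩ = 0 from this)
    rw [Matrix.mulVecLin_apply]
    refine Finset.sum_congr rfl fun j _ => ?_
    exact congrArg (fun z => T k j * z) (dif_pos j.2)

theorem bandOp_sum (m : ℕ) (d : ℕ → ℝ) (a : ℕ → ℕ → ℝ) (s : Finset ℕ) (c : ℕ → ℂ)
    (u : ℕ → ℕ → ℂ) (j : ℕ) :
    bandOp m d a (fun i => ∑ k ∈ s, c k * u k i) j = ∑ k ∈ s, c k * bandOp m d a (u k) j := by
  unfold bandOp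
  simp_rw [offDiag_eq m a _ j (j + m + 1) (by omega), mul_add, Finset.sum_add_distrib,
    Finset.mul_sum]
  congr 1
  · exact Finset.sum_congr rfl fun k _ => by ring
  · rw [Finset.sum_comm]
    exact Finset.sum_congr rfl fun k _ => Finset.sum_congr rfl fun i _ => by ring

theorem lower_bound (m : ℕ) (d : ℕ → ℝ) (a : ℕ → ℕ → ℝ) (α : ℕ → ℝ)
    (lam : ℕ → ℝ) (v : ℕ → lp (fun _ : ℕ => ℂ) 2)
    (heig : IsEigenSystem m d a lam v)
    (hα : ∀ j, (∑ l ∈ Finset.Icc 1 m, (|a l j| + if l ≤ j then |a l (j - l)| else 0)) ≤ α j)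
    (n : ℕ) (hd : ∀ j ≥ n, 0 < d j) (δ : ℝ) (hδ : 0 < δ) (hδm : 4 * m * δ ≤ 1)
    (hδα : ∀ j ≥ n, α j ≤ δ * d j) (hmono : ∀ j ≥ n, d n - α n ≤ d j - α j) :
    d n - α n ≤ lam n := by
  obtain ⟨hon, -, hlam, -, hev⟩ := heig
  obtain ⟨c, hc0, ⟨p, hp⟩, hc⟩ := exists_comb n (fun k j => v j k)
  set s := Finset.range (n + 1) with hs
  let x : lp (fun _ : ℕ => ℂ) 2 := ∑ k ∈ s, c k • v k
  let g : lp (fun _ : ℕ => ℂ) 2 := ∑ k ∈ s, (c k * lam k) • v k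
  have hxj : ∀ j, x j = ∑ k ∈ s, c k * v k j := by
    intro j
    simp only [x, lp.coeFn_sum, Finset.sum_apply, lp.coeFn_smul, Pi.smul_apply, smul_eq_mul]
  have hgj : ∀ j, g j = bandOp m d a x j := by
    intro j
    have : (x : ℕ → ℂ) = fun i => ∑ k ∈ s, c k * v k i := funext hxj
    rw [this, bandOp_sum]
    simp only [g, lp.coeFn_sum, Finset.sum_apply, lp.coeFn_smul, Pi.smul_apply, smul_eq_mul]
    refine Finset.sum_congr rfl fun k _ => ?_
    rw [hev]; ring
  have hx0 : ∀ j < n, x j = 0 := by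
    intro j hj
    rw [hxj, ← hc j hj]
    exact Finset.sum_congr rfl fun k _ => mul_comm _ _
  have hxg : (inner ℂ x g).re = ∑ k ∈ s, lam k * ‖c k‖ ^ 2 := by
    rw [hon.inner_sum, Complex.re_sum]
    refine Finset.sum_congr rfl fun k _ => ?_
    rw [← mul_assoc, Complex.conj_mul', ← Complex.ofReal_pow, ← Complex.ofReal_mul, Complex.ofReal_re]
    ring
  have hxx : (inner ℂ x x).re = ∑ k ∈ s, ‖c k‖ ^ 2 := by
    rw [hon.inner_sum, Complex.re_sum]
    refine Finset.sum_congr rfl fun k _ => ?_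
    rw [Complex.conj_mul', ← Complex.ofReal_pow, Complex.ofReal_re]
  have hpos : 0 < ∑ k ∈ s, ‖c k‖ ^ 2 := by
    refine Finset.sum_pos' (fun _ _ => by positivity) ⟨p, ?_, by positivity⟩
    rw [hs, Finset.mem_range]
    by_contra h
    exact hp (hc0 p (by omega))
  have hle : (inner ℂ x g).re ≤ lam n * ∑ k ∈ s, ‖c k‖ ^ 2 := by
    rw [hxg, Finset.mul_sum]
    refine Finset.sum_le_sum fun k hk => ?_
    rw [hs, Finset.mem_range] at hk
    have := hlam (show k ≤ n by omega)
    gcongr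
  -- regularity
  have hreg := reg m d a α hα n hd δ hδ hδm hδα x hx0 ‖x‖ (fun j => lp.norm_apply_le_norm (by simp) x j)
    ‖g‖ (fun j => by rw [← hgj]; exact lp.norm_apply_le_norm (by simp) g j)
  have hT1 := (lp.hasSum_inner (𝕜 := ℂ) x g).tendsto_sum_nat
  have hT2 := (lp.hasSum_inner (𝕜 := ℂ) x x).tendsto_sum_nat
  have hT1 := (Complex.continuous_re.tendsto _).comp hT1
  have hT2 := (Complex.continuous_re.tendsto _).comp hT2
  have hxz : Tendsto (fun j => ‖x j‖) atTop (nhds 0) := by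
    have h1 := (lp.hasSum_inner (𝕜 := ℂ) x x).summable.norm.tendsto_atTop_zero
    have h2 := h1.sqrt
    rw [Real.sqrt_zero] at h2
    refine h2.congr fun j => ?_
    rw [inner_self_eq_norm_sq_to_K]
    simp
  have hαz : Tendsto (fun j => α j * ‖x j‖ ^ 2) atTop (nhds 0) := by
    have hb : Tendsto (fun j => δ * (2 * ‖g‖) * ‖x j‖) atTop (nhds 0) := by
      simpa using hxz.const_mul (δ * (2 * ‖g‖))
    refine squeeze_zero' (Eventually.of_forall fun j => ?_) ?_ hb
    · have := alpha_nonneg m a α hα j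
      positivity
    · filter_upwards [eventually_ge_atTop n] with j hj
      calc α j * ‖x j‖ ^ 2 ≤ δ * d j * ‖x j‖ ^ 2 := by gcongr; exact hδα j hj
        _ = δ * (d j * ‖x j‖) * ‖x j‖ := by ring
        _ ≤ _ := mul_le_mul_of_nonneg_right
            (mul_le_mul_of_nonneg_left (hreg j) hδ.le) (norm_nonneg _)
  have htail : Tendsto (fun N => (∑ i ∈ Finset.range m, α (N + i) * ‖x (N + i)‖ ^ 2) / 2)
      atTop (nhds 0) := by
    have : Tendsto (fun N => (∑ i ∈ Finset.range m, α (N + i) * ‖x (N + i)‖ ^ 2))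
        atTop (nhds (∑ i ∈ Finset.range m, 0)) :=
      tendsto_finsetSum _ fun i _ => hαz.comp (tendsto_add_atTop_nat i)
    simpa using this.div_const 2
  have hfin : (d n - α n) * (inner ℂ x x).re ≤ (inner ℂ x g).re + 0 := by
    refine le_of_tendsto_of_tendsto' (hT2.const_mul (d n - α n)) (hT1.add htail) fun N => ?_
    have hf := (abs_le.1 (form_est m d a α hα x N)).1
    have e1 : (∑ i ∈ Finset.range N, inner ℂ (x i) (g i)) =
        ∑ j ∈ Finset.range N, bandOp m d a x j * (starRingEnd ℂ) (x j) :=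
      Finset.sum_congr rfl fun j _ => by rw [hgj]; simp
    have e2 : (∑ i ∈ Finset.range N, inner ℂ (x i) (x i)).re =
        ∑ j ∈ Finset.range N, ‖x j‖ ^ 2 := by
      rw [Complex.re_sum]
      refine Finset.sum_congr rfl fun j _ => ?_
      rw [inner_self_eq_norm_sq_to_K]
      simp [← Complex.ofReal_pow]
    simp only [Function.comp_apply]
    rw [e1, e2]
    rw [Finset.sum_range_add] at hf
    have h3 : (d n - α n) * ∑ j ∈ Finset.range N, ‖x j‖ ^ 2 ≤
        ∑ j ∈ Finset.range N, d j * ‖x j‖ ^ 2 - ∑ j ∈ Finset.range N, α j * ‖x j‖ ^ 2 := by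
      rw [Finset.mul_sum, ← Finset.sum_sub_distrib]
      refine Finset.sum_le_sum fun j _ => ?_
      rcases lt_or_ge j n with hj | hj
      · rw [hx0 j hj]; simp
      · rw [← sub_mul]
        gcongr ?_ * _
        exact hmono j hj
    linarith
  rw [hxx, add_zero] at hfin
  exact le_of_mul_le_mul_right (hfin.trans hle) hpos

theorem upper_bound (m : ℕ) (d : ℕ → ℝ) (a : ℕ → ℕ → ℝ) (α : ℕ → ℝ)
    (lam : ℕ → ℝ) (v : ℕ → lp (fun _ : ℕ => ℂ) 2)
    (heig : IsEigenSystem m d a lam v)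
    (hα : ∀ j, (∑ l ∈ Finset.Icc 1 m, (|a l j| + if l ≤ j then |a l (j - l)| else 0)) ≤ α j)
    (n : ℕ) (hmono : ∀ j ≤ n, d j + α j ≤ d n + α n) :
    lam n ≤ d n + α n := by
  obtain ⟨hon, hsp, hlam, -, hev⟩ := heig
  obtain ⟨c, hc0, ⟨p, hp⟩, hc⟩ := exists_comb n (fun k j => (starRingEnd ℂ) (v k j))
  have memfin : ∀ (f : ℕ → ℂ) (N : ℕ), (∀ j, N ≤ j → f j = 0) → Memℓp f 2 := by
    intro f N hf
    refine memℓp_gen ?_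
    refine summable_of_ne_finset_zero (s := Finset.range N) fun j hj => ?_
    rw [hf j (by simpa using hj)]
    simp
  have hg0 : ∀ j, n + m + 1 ≤ j → bandOp m d a c j = 0 := by
    intro j hj
    unfold bandOp
    rw [offDiag_eq m a c j (j + m + 1) (by omega), hc0 j (by omega), mul_zero, zero_add]
    refine Finset.sum_eq_zero fun i _ => ?_
    rcases lt_or_ge n i with hi | hi
    · rw [hc0 i hi, mul_zero]
    · rw [bandM_symm, bandM_zero _ _ _ _ (by omega), zero_mul]
  let x : lp (fun _ : ℕ => ℂ) 2 := ⟨c, memfin c (n + 1) fun j hj => hc0 j (by omega)⟩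
  let g : lp (fun _ : ℕ => ℂ) 2 := ⟨bandOp m d a c, memfin _ (n + m + 1) hg0⟩
  have hinx : ∀ (u : lp (fun _ : ℕ => ℂ) 2) (N : ℕ), n < N →
      inner ℂ u x = ∑ j ∈ Finset.range N, c j * (starRingEnd ℂ) (u j) := by
    intro u N hN
    rw [lp.inner_eq_tsum, tsum_eq_sum (s := Finset.range N)]
    · exact Finset.sum_congr rfl fun j _ => by simp [x]
    · intro j hj
      have : c j = 0 := hc0 j (by simp at hj; omega)
      simp [x, this]
  have hing : ∀ (u : lp (fun _ : ℕ => ℂ) 2),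
      inner ℂ u g = ∑ j ∈ Finset.range (n + m + 1), bandOp m d a c j * (starRingEnd ℂ) (u j) := by
    intro u
    rw [lp.inner_eq_tsum, tsum_eq_sum (s := Finset.range (n + m + 1))]
    · exact Finset.sum_congr rfl fun j _ => by simp [g]
    · intro j hj
      have : bandOp m d a c j = 0 := hg0 j (by simpa using hj)
      simp [g, this]
  have hvg : ∀ k, inner ℂ (v k) g = lam k * inner ℂ (v k) x := by
    intro k
    rw [hing, hinx (v k) (n + m + 1) (by omega), Finset.mul_sum]
    have r : ∀ j ∈ Finset.range (n + m + 1), (lam k : ℂ) * (c j * (starRingEnd ℂ) (v k j)) =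
        c j * (starRingEnd ℂ) (bandOp m d a (v k) j) := by
      intro j _
      rw [hev, map_mul, Complex.conj_ofReal]; ring
    rw [Finset.sum_congr rfl r]
    unfold bandOp
    simp_rw [add_mul, map_add, mul_add, Finset.sum_add_distrib]
    congr 1
    · refine Finset.sum_congr rfl fun j _ => ?_
      rw [map_mul, Complex.conj_ofReal]; ring
    · have l1 : ∀ j ∈ Finset.range (n + m + 1), offDiagOp m a c j * (starRingEnd ℂ) (v k j) =
          ∑ i ∈ Finset.range (n + m + 1),
            bandM m (fun l j => (a l j : ℂ)) j i * c i * (starRingEnd ℂ) (v k j) := by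
        intro j hj
        rw [Finset.mem_range] at hj
        rw [offDiag_eq m a c j (n + m + 1 + m) (by omega), Finset.sum_mul]
        symm
        refine Finset.sum_subset (Finset.range_mono (by omega)) fun i _ hi => ?_
        rw [hc0 i (by simp at hi; omega)]; simp
      have l2 : ∀ j ∈ Finset.range (n + m + 1), c j * (starRingEnd ℂ) (offDiagOp m a (v k) j) =
          ∑ i ∈ Finset.range (n + m + 1),
            bandM m (fun l j => (a l j : ℂ)) j i * c j * (starRingEnd ℂ) (v k i) := by
        intro j _
        rcases lt_or_ge n j with hj | hj
        · rw [hc0 j hj]; simp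
        rw [offDiag_eq m a _ j (n + m + 1) (by omega), map_sum, Finset.mul_sum]
        refine Finset.sum_congr rfl fun i _ => ?_
        rw [map_mul, bandM_conj]; ring
      rw [Finset.sum_congr rfl l1, Finset.sum_congr rfl l2, Finset.sum_comm]
      refine Finset.sum_congr rfl fun i _ => Finset.sum_congr rfl fun j _ => ?_
      rw [bandM_symm]
  have hvx : ∀ k < n, inner ℂ (v k) x = 0 := by
    intro k hk
    rw [hinx _ (n + 1) (by omega), ← hc k hk]
    exact Finset.sum_congr rfl fun j _ => mul_comm _ _
  let b : HilbertBasis ℕ ℂ (lp (fun _ : ℕ => ℂ) 2) := HilbertBasis.mk hon hsp.ge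
  have hb : ∀ k, b k = v k := fun k => by simp [b]
  have P1 := Complex.hasSum_re (b.hasSum_inner_mul_inner x g)
  have P2 := Complex.hasSum_re (b.hasSum_inner_mul_inner x x)
  have hre : ∀ k, inner ℂ x (v k) * inner ℂ (v k) x = ((‖inner ℂ (v k) x‖ ^ 2 : ℝ) : ℂ) := by
    intro k
    rw [← inner_conj_symm x (v k), Complex.conj_mul']
    simp
  have hge : lam n * (inner ℂ x x).re ≤ (inner ℂ x g).re := by
    refine hasSum_le (fun k => ?_) (P2.mul_left (lam n)) P1
    rw [hb, hvg, mul_left_comm, hre, ← Complex.ofReal_mul, Complex.ofReal_re, Complex.ofReal_re]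
    rcases lt_or_ge k n with hk | hk
    · rw [hvx k hk]; simp
    · have := hlam hk
      gcongr
  have hxx : (inner ℂ x x).re = ∑ j ∈ Finset.range (n + m + 1), ‖c j‖ ^ 2 := by
    rw [hinx x (n + m + 1) (by omega), Complex.re_sum]
    refine Finset.sum_congr rfl fun j _ => ?_
    change (c j * (starRingEnd ℂ) (c j)).re = _
    rw [Complex.mul_conj', ← Complex.ofReal_pow, Complex.ofReal_re]
  have hpos : 0 < (inner ℂ x x).re := by
    rw [hxx]
    refine Finset.sum_pos' (fun _ _ => by positivity) ⟨p, ?_, by positivity⟩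
    rw [Finset.mem_range]
    by_contra h
    exact hp (hc0 p (by omega))
  have hle : (inner ℂ x g).re ≤ (d n + α n) * (inner ℂ x x).re := by
    have hf := (abs_le.1 (form_est m d a α hα c (n + m + 1))).2
    have e : ∑ j ∈ Finset.range (n + m + 1 + m), α j * ‖c j‖ ^ 2 =
        ∑ j ∈ Finset.range (n + m + 1), α j * ‖c j‖ ^ 2 := by
      symm
      refine Finset.sum_subset (Finset.range_mono (by omega)) fun i _ hi => ?_
      rw [hc0 i (by simp at hi; omega)]; simp
    have h3 : ∑ j ∈ Finset.range (n + m + 1), d j * ‖c j‖ ^ 2 +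
        ∑ j ∈ Finset.range (n + m + 1), α j * ‖c j‖ ^ 2 ≤
        (d n + α n) * ∑ j ∈ Finset.range (n + m + 1), ‖c j‖ ^ 2 := by
      rw [Finset.mul_sum, ← Finset.sum_add_distrib]
      refine Finset.sum_le_sum fun j _ => ?_
      rcases lt_or_ge n j with hj | hj
      · rw [hc0 j hj]; simp
      · rw [← add_mul]
        gcongr ?_ * _
        exact hmono j hj
    have e3 : (inner ℂ x g) = ∑ j ∈ Finset.range (n + m + 1),
        bandOp m d a c j * (starRingEnd ℂ) (c j) := hing x
    rw [e3, hxx]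
    rw [e] at hf
    linarith
  exact le_of_mul_le_mul_right (hge.trans hle) hpos

/-- In the setting of Statement 4, if moreover
`|α(j+1) − α(j)| ≤ d(j+1) − d(j)` for all `j ≥ j₀`, then
`|λ_n(A) − d(n)| ≤ α(n)` for all large `n`. -/
theorem eigenvalue_close_to_diagonal
    (m : ℕ) (d : ℕ → ℝ) (a : ℕ → ℕ → ℝ) (α : ℕ → ℝ)
    (hsa : StandingAssumptions m d a)
    (lam : ℕ → ℝ) (v : ℕ → lp (fun _ : ℕ => ℂ) 2)
    (heig : IsEigenSystem m d a lam v)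
    (hα : ∀ j, (∑ l ∈ Finset.Icc 1 m, (|a l j| + if l ≤ j then |a l (j - l)| else 0)) ≤ α j)
    (hαd : Tendsto (fun j => α j / d j) atTop (nhds 0))
    (j₀ : ℕ) (hΔ : ∀ j ≥ j₀, |α (j + 1) - α j| ≤ d (j + 1) - d j) :
    ∃ n₁ : ℕ, ∀ n ≥ n₁, |lam n - d n| ≤ α n := by
  obtain ⟨-, hdt⟩ := hsa
  set δ : ℝ := 1 / (4 * (m + 1)) with hδdef
  have hδ : 0 < δ := by positivity
  have hδm : 4 * m * δ ≤ 1 := by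
    rw [hδdef, mul_one_div, div_le_one (by positivity)]
    linarith
  have ev : ∀ᶠ j in atTop, 0 < d j ∧ α j ≤ δ * d j := by
    filter_upwards [hdt.eventually_gt_atTop 0, hαd.eventually_lt_const hδ] with j h1 h2
    exact ⟨h1, ((div_lt_iff₀ h1).1 h2).le⟩
  obtain ⟨J, hJ⟩ := eventually_atTop.1 ev
  have mono1 : ∀ n ≥ j₀, ∀ j ≥ n, d n - α n ≤ d j - α j ∧ d n + α n ≤ d j + α j := by
    intro n hn j hj
    induction j, hj using Nat.le_induction with
    | base => exact ⟨le_rfl, le_rfl⟩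
    | succ j hj ih =>
      have := abs_le.1 (hΔ j (by omega))
      constructor <;> linarith [ih.1, ih.2, this.1, this.2]
  have evd : ∀ᶠ n in atTop, ∀ j ∈ Finset.range j₀, d j + α j ≤ d n := by
    rw [Filter.eventually_all_finset]
    intro j _
    exact hdt.eventually_ge_atTop _
  obtain ⟨J2, hJ2⟩ := eventually_atTop.1 evd
  refine ⟨max (max J j₀) J2, fun n hn => ?_⟩
  have hn1 : J ≤ n := by omega
  have hn2 : j₀ ≤ n := by omega
  have hn3 : J2 ≤ n := by omega
  have lo := lower_bound m d a α lam v heig hα n (fun j hj => (hJ j (by omega)).1) δ hδ hδm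
    (fun j hj => (hJ j (by omega)).2) (fun j hj => (mono1 n hn2 j hj).1)
  have up := upper_bound m d a α lam v heig hα n (fun j hj => by
    rcases lt_or_ge j j₀ with h | h
    · have := hJ2 n hn3 j (Finset.mem_range.2 h)
      linarith [alpha_nonneg m a α hα n]
    · exact (mono1 j h n hj).2)
  rw [abs_le]
  constructor <;> linarith
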